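/- arXiv:1301.0907 — 5 statements merged into one kernel-verified Lean document; each statement's English description precedes it below -/
import Mathlib

section
/- Let N ≥ 2, let S₁, …, S_N be positive real numbers that are not all equal, and let r > −1 be such that min_i S_i < 1 + r < (1/N)∑_{i=1}^N S_i. Then there exists a unique b ∈ ℝ satisfying (1+r)·∑_{i=1}^N S_i^b = ∑_{i=1}^N S_i^{b+1}, and this b is strictly negative. -/
open Finset in
/-- The normalised excess `∑ i, (S i / c) ^ b * (S i - c)` vanishes exactly when
`c * ∑ i, S i ^ b = ∑ i, S i ^ (b + 1)`. -/
lemma mul_sum_rpow_eq_sum_rpow_add_one_iff {ι : Type*} [Fintype ι] {S : ι → ℝ} {c : ℝ}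
    (hS : ∀ i, 0 < S i) (hc : 0 < c) (b : ℝ) :
    c * ∑ i, S i ^ b = ∑ i, S i ^ (b + 1) ↔ ∑ i, (S i / c) ^ b * (S i - c) = 0 := by
  have key : ∑ i, S i ^ (b + 1) - c * ∑ i, S i ^ b =
      c ^ b * ∑ i, (S i / c) ^ b * (S i - c) := by
    rw [mul_sum, mul_sum, ← sum_sub_distrib]
    refine sum_congr rfl fun i _ => ?_
    have := (Real.rpow_pos_of_pos hc b).ne'
    rw [Real.rpow_add_one (hS i).ne', Real.div_rpow (hS i).le hc.le]
    field_simp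
  rw [eq_comm, ← sub_eq_zero, key, mul_eq_zero, or_iff_right (Real.rpow_pos_of_pos hc b).ne']

lemma strictMono_div_rpow_mul_sub {a c : ℝ} (ha : 0 < a) (hc : 0 < c) (hac : a ≠ c) :
    StrictMono fun b : ℝ => (a / c) ^ b * (a - c) := by
  intro x y hxy
  rcases hac.lt_or_gt with h | h
  · exact mul_lt_mul_of_neg_right
      (Real.rpow_lt_rpow_of_exponent_gt (div_pos ha hc) ((div_lt_one hc).2 h) hxy)
      (sub_neg.2 h)
  · exact mul_lt_mul_of_pos_right
      (Real.rpow_lt_rpow_of_exponent_lt ((one_lt_div hc).2 h) hxy) (sub_pos.2 h)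

lemma monotone_div_rpow_mul_sub {a c : ℝ} (ha : 0 < a) (hc : 0 < c) :
    Monotone fun b : ℝ => (a / c) ^ b * (a - c) := by
  rcases eq_or_ne a c with rfl | h
  · simpa using monotone_const
  · exact (strictMono_div_rpow_mul_sub ha hc h).monotone

lemma strictMono_sum_div_rpow_mul_sub {ι : Type*} [Fintype ι] {S : ι → ℝ} {c : ℝ}
    (hS : ∀ i, 0 < S i) (hc : 0 < c) (h : ∃ i, S i ≠ c) :
    StrictMono fun b : ℝ => ∑ i, (S i / c) ^ b * (S i - c) := by
  obtain ⟨m, hm⟩ := h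
  exact fun x y hxy => Finset.sum_lt_sum
    (fun i _ => monotone_div_rpow_mul_sub (hS i) hc hxy.le)
    ⟨m, Finset.mem_univ m, strictMono_div_rpow_mul_sub (hS m) hc hm hxy⟩

open Finset Filter in
lemma tendsto_sum_div_rpow_mul_sub_atBot {ι : Type*} [Fintype ι] {S : ι → ℝ} {c : ℝ}
    (hS : ∀ i, 0 < S i) (hc : 0 < c) (h : ∃ i, S i < c) :
    Tendsto (fun b : ℝ => ∑ i, (S i / c) ^ b * (S i - c)) atBot atBot := by
  classical
  obtain ⟨m, hm⟩ := h
  have hlim : Tendsto (fun b : ℝ => (S m / c) ^ b * (S m - c)) atBot atBot :=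
    (tendsto_rpow_atBot_of_base_lt_one _ (div_pos (hS m) hc)
      ((div_lt_one hc).2 hm)).atTop_mul_const_of_neg (sub_neg.2 hm)
  refine tendsto_atBot_mono' _ ?_
    (tendsto_atBot_add_const_right _ (∑ i ∈ univ.erase m, (S i - c)) hlim)
  filter_upwards [eventually_le_atBot 0] with b hb
  rw [← add_sum_erase univ _ (mem_univ m)]
  gcongr with i
  simpa using monotone_div_rpow_mul_sub (hS i) hc hb

/-- In Sharpe et al.'s single-period model with `N ≥ 2` equally probable states, stock
values `S i` (positive, not all equal) and interest rate `r > -1` with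
`min_i S i < 1 + r < (1/N) ∑ i, S i`, there exists a unique `b ∈ ℝ` satisfying
`(1+r) ∑ i, S i ^ b = ∑ i, S i ^ (b+1)`, and this `b` is strictly negative. -/
theorem distribution_builder_state_price_exponent_exists_unique_neg
    {N : ℕ} (hN : 2 ≤ N) (S : Fin N → ℝ) (hpos : ∀ i, 0 < S i)
    (hne : ¬ ∀ i j, S i = S j) (r : ℝ) (hr : -1 < r)
    (hlo : Finset.univ.inf' ⟨⟨0, by omega⟩, Finset.mem_univ _⟩ S < 1 + r)
    (hhi : 1 + r < (1 / (N : ℝ)) * ∑ i, S i) :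
    (∃! b : ℝ, (1 + r) * ∑ i, S i ^ b = ∑ i, S i ^ (b + 1)) ∧
    ∀ b : ℝ, (1 + r) * ∑ i, S i ^ b = ∑ i, S i ^ (b + 1) → b < 0 := by
  have hc : 0 < 1 + r := by linarith
  obtain ⟨m, -, hm⟩ := (Finset.inf'_lt_iff _).1 hlo
  have hmono := strictMono_sum_div_rpow_mul_sub hpos hc ⟨m, hm.ne⟩
  have hzero : 0 < ∑ i, (S i / (1 + r)) ^ (0 : ℝ) * (S i - (1 + r)) := by
    have hN0 : (0 : ℝ) < N := by exact_mod_cast (by omega : 0 < N)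
    rw [one_div, ← div_eq_inv_mul, lt_div_iff₀ hN0] at hhi
    simp only [Real.rpow_zero, one_mul, Finset.sum_sub_distrib, Finset.sum_const,
      Finset.card_univ, Fintype.card_fin, nsmul_eq_mul]
    linarith
  have hcont : Continuous fun b : ℝ => ∑ i, (S i / (1 + r)) ^ b * (S i - (1 + r)) :=
    continuous_finsetSum _ fun i _ =>
      (Real.continuous_const_rpow (div_pos (hpos i) hc).ne').mul continuous_const
  obtain ⟨a, ha⟩ := ((tendsto_sum_div_rpow_mul_sub_atBot hpos hc ⟨m, hm⟩).eventually
    (Filter.eventually_le_atBot 0)).exists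
  obtain ⟨b, hb⟩ := mem_range_of_exists_le_of_exists_ge hcont ⟨a, ha⟩ ⟨0, hzero.le⟩
  simp only [mul_sum_rpow_eq_sum_rpow_add_one_iff hpos hc]
  exact ⟨⟨b, hb, fun y hy => hmono.injective (hy.trans hb.symm)⟩,
    fun y hy => hmono.lt_iff_lt.1 (hy.trans_lt hzero)⟩
end

section
/- Let ν ∈ B⁺ with ν ≠ 0, and define h(x,t) = ∫_{(0,∞)} (e^{yx − y²t/2}/y) ν(dy) for (x,t) ∈ ℝ × [0,∞). Then h is well-defined and finite, h(x,t) > 0 for all (x,t), for each fixed t ≥ 0 the map x ↦ h(x,t) is strictly increasing, h is continuous on ℝ × [0,∞), and h satisfies the backward heat equation ∂_t h(x,t) + (1/2) ∂_{xx} h(x,t) = 0 for all (x,t) ∈ ℝ × (0,∞). -/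
open MeasureTheory Set Filter

/-- Multiplication by the identity preserves integrability against all exponentials. -/
theorem integrable_mul_id_mul_exp {μ : Measure ℝ} (hpos : ∀ᵐ y ∂μ, 0 < y) {g : ℝ → ℝ}
    (hg : Measurable g) (hi : ∀ x : ℝ, Integrable (fun y => g y * Real.exp (y * x)) μ) (x : ℝ) :
    Integrable (fun y => g y * y * Real.exp (y * x)) μ := by
  refine (hi (x + 1)).mono (by fun_prop) ?_
  filter_upwards [hpos] with y hy
  have h1 : y ≤ Real.exp y := by linarith [Real.add_one_le_exp y]
  have h2 : Real.exp (y * (x + 1)) = Real.exp y * Real.exp (y * x) := by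
    rw [← Real.exp_add]
    ring_nf
  rw [norm_mul, norm_mul, norm_mul, h2, norm_mul, Real.norm_of_nonneg hy.le, mul_assoc,
    Real.norm_of_nonneg (Real.exp_nonneg y)]
  gcongr

theorem norm_mul_exp_heat_le (c : ℝ) {x X y t : ℝ} (hy : 0 < y) (ht : 0 ≤ t) (hx : x ≤ X) :
    ‖c * Real.exp (y * x - y ^ 2 * t / 2)‖ ≤ ‖c * Real.exp (y * X)‖ := by
  rw [norm_mul, norm_mul, Real.norm_of_nonneg (Real.exp_nonneg _),
    Real.norm_of_nonneg (Real.exp_nonneg _)]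
  have h1 : y * x ≤ y * X := by gcongr
  have h2 : 0 ≤ y ^ 2 * t / 2 := by positivity
  gcongr
  linarith

theorem integrable_mul_exp_heat {μ : Measure ℝ} (hpos : ∀ᵐ y ∂μ, 0 < y) {g : ℝ → ℝ}
    (hg : Measurable g) (hi : ∀ x : ℝ, Integrable (fun y => g y * Real.exp (y * x)) μ)
    (x : ℝ) {t : ℝ} (ht : 0 ≤ t) :
    Integrable (fun y => g y * Real.exp (y * x - y ^ 2 * t / 2)) μ := by
  refine (hi x).mono (by fun_prop) ?_
  filter_upwards [hpos] with y hy
  exact norm_mul_exp_heat_le _ hy ht le_rfl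

theorem hasDerivAt_integral_mul_exp_heat_space {μ : Measure ℝ} (hpos : ∀ᵐ y ∂μ, 0 < y)
    {g : ℝ → ℝ} (hg : Measurable g)
    (hi : ∀ x : ℝ, Integrable (fun y => g y * Real.exp (y * x)) μ) (x : ℝ) {t : ℝ} (ht : 0 ≤ t) :
    HasDerivAt (fun z => ∫ y, g y * Real.exp (y * z - y ^ 2 * t / 2) ∂μ)
      (∫ y, g y * y * Real.exp (y * x - y ^ 2 * t / 2) ∂μ) x := by
  refine (hasDerivAt_integral_of_dominated_loc_of_deriv_le (s := Iio (x + 1))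
    (F := fun z y => g y * Real.exp (y * z - y ^ 2 * t / 2))
    (F' := fun z y => g y * y * Real.exp (y * z - y ^ 2 * t / 2))
    (bound := fun y => ‖g y * y * Real.exp (y * (x + 1))‖) (Iio_mem_nhds (by linarith))
    (Eventually.of_forall fun z => by fun_prop) (integrable_mul_exp_heat hpos hg hi x ht)
    (by fun_prop) ?_ (integrable_mul_id_mul_exp hpos hg hi (x + 1)).norm ?_).2
  · filter_upwards [hpos] with y hy z hz
    exact norm_mul_exp_heat_le _ hy ht (le_of_lt hz)
  · refine Eventually.of_forall fun y z _ => ?_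
    refine ((((hasDerivAt_id z).const_mul y).sub_const
      (y ^ 2 * t / 2)).exp.const_mul (g y)).congr_deriv ?_
    simp only [id]
    ring

theorem hasDerivAt_integral_mul_exp_heat_time {μ : Measure ℝ} (hpos : ∀ᵐ y ∂μ, 0 < y)
    {g : ℝ → ℝ} (hg : Measurable g)
    (hi : ∀ x : ℝ, Integrable (fun y => g y * Real.exp (y * x)) μ) (x : ℝ) {t : ℝ} (ht : 0 < t) :
    HasDerivAt (fun s => ∫ y, g y * Real.exp (y * x - y ^ 2 * s / 2) ∂μ)
      (-(1 / 2) * ∫ y, g y * y * y * Real.exp (y * x - y ^ 2 * t / 2) ∂μ) t := by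
  have hi' := integrable_mul_id_mul_exp hpos (by fun_prop) (integrable_mul_id_mul_exp hpos hg hi)
  rw [← integral_const_mul]
  refine (hasDerivAt_integral_of_dominated_loc_of_deriv_le (s := Ioi 0)
    (F := fun s y => g y * Real.exp (y * x - y ^ 2 * s / 2))
    (F' := fun s y => -(1 / 2) * (g y * y * y * Real.exp (y * x - y ^ 2 * s / 2)))
    (bound := fun y => ‖(-(1 / 2) : ℝ)‖ * ‖g y * y * y * Real.exp (y * x)‖) (Ioi_mem_nhds ht)
    (Eventually.of_forall fun z => by fun_prop) (integrable_mul_exp_heat hpos hg hi x ht.le)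
    (by fun_prop) ?_ ((hi' x).norm.const_mul _) ?_).2
  · filter_upwards [hpos] with y hy s hs
    rw [norm_mul]
    exact mul_le_mul_of_nonneg_left (norm_mul_exp_heat_le _ hy (le_of_lt hs) le_rfl)
      (norm_nonneg _)
  · refine Eventually.of_forall fun y s _ => ?_
    refine (((((hasDerivAt_id s).const_mul (y ^ 2)).div_const 2).const_sub
      (y * x)).exp.const_mul (g y)).congr_deriv ?_
    simp only [id]
    ring

theorem continuousOn_integral_mul_exp_heat {μ : Measure ℝ} (hpos : ∀ᵐ y ∂μ, 0 < y)
    {g : ℝ → ℝ} (hg : Measurable g)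
    (hi : ∀ x : ℝ, Integrable (fun y => g y * Real.exp (y * x)) μ) :
    ContinuousOn (fun p : ℝ × ℝ => ∫ y, g y * Real.exp (y * p.1 - y ^ 2 * p.2 / 2) ∂μ)
      (univ ×ˢ Ici 0) := by
  rintro ⟨x, t⟩ _
  refine continuousWithinAt_of_dominated (bound := fun y => ‖g y * Real.exp (y * (x + 1))‖)
    (Eventually.of_forall fun p => by fun_prop) ?_ (hi (x + 1)).norm
    (Eventually.of_forall fun y => by fun_prop)
  have hx : ∀ᶠ p : ℝ × ℝ in nhds (x, t), p.1 < x + 1 :=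
    continuous_fst.continuousAt.eventually_lt_const (by simp)
  filter_upwards [mem_nhdsWithin_of_mem_nhds hx, self_mem_nhdsWithin] with p hp hp'
  filter_upwards [hpos] with y hy
  exact norm_mul_exp_heat_le _ hy hp'.2 (le_of_lt hp)

theorem integral_pos_of_ae_pos {α : Type*} [MeasurableSpace α] {μ : Measure α} (hμ : μ ≠ 0)
    {f : α → ℝ} (hf : Integrable f μ) (hpos : ∀ᵐ a ∂μ, 0 < f a) : 0 < ∫ a, f a ∂μ := by
  rw [integral_pos_iff_support_of_nonneg_ae (hpos.mono fun a ha => ha.le) hf, pos_iff_ne_zero]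
  intro h0
  apply hμ
  rw [← ae_eq_bot, ← Filter.eventually_false_iff_eq_bot]
  have h1 : ∀ᵐ a ∂μ, a ∉ Function.support f := measure_eq_zero_iff_ae_notMem.1 h0
  filter_upwards [hpos, h1] with a ha ha'
  exact ha' ha.ne'

/-- For a nonzero finite Borel measure `ν` in the class `B⁺` (supported on `(0,∞)`, with
`∫ ν(dy)/y < ∞` and finite Laplace transform everywhere), the function
`h(x,t) = ∫_{(0,∞)} e^{yx - y²t/2}/y ν(dy)` is well defined and finite, positive,
strictly increasing in `x` for each `t ≥ 0`, jointly continuous on `ℝ × [0,∞)`,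
and satisfies the backward heat equation `h_t + (1/2) h_xx = 0` on `ℝ × (0,∞)`. -/
theorem forward_harmonic_from_measure
    (ν : Measure ℝ) [IsFiniteMeasure ν] (hν : ν ≠ 0)
    (hsupp : ν (Iic 0) = 0)
    (hinv : IntegrableOn (fun y : ℝ => 1 / y) (Ioi 0) ν)
    (hexp : ∀ x : ℝ, IntegrableOn (fun y : ℝ => Real.exp (y * x)) (Ioi 0) ν)
    (h : ℝ → ℝ → ℝ)
    (hdef : ∀ x t : ℝ, h x t = ∫ y in Ioi 0, Real.exp (y * x - y ^ 2 * t / 2) / y ∂ν) :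
    (∀ x t : ℝ, 0 ≤ t →
      IntegrableOn (fun y : ℝ => Real.exp (y * x - y ^ 2 * t / 2) / y) (Ioi 0) ν) ∧
    (∀ x t : ℝ, 0 ≤ t → 0 < h x t) ∧
    (∀ t : ℝ, 0 ≤ t → StrictMono fun x => h x t) ∧
    ContinuousOn (fun p : ℝ × ℝ => h p.1 p.2) (univ ×ˢ Ici 0) ∧
    (∀ x t : ℝ, 0 < t →
      deriv (fun s => h x s) t + (1 / 2) * iteratedDeriv 2 (fun z => h z t) x = 0) := by
  have hμ : ν.restrict (Ioi 0) ≠ 0 := by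
    rw [Ne, Measure.restrict_eq_zero]
    intro h0
    apply hν
    rw [← Measure.measure_univ_eq_zero, ← Iic_union_Ioi (a := (0 : ℝ))]
    exact measure_union_null hsupp h0
  have hpos : ∀ᵐ y ∂ν.restrict (Ioi 0), 0 < y := ae_restrict_mem measurableSet_Ioi
  have hg : Measurable fun y : ℝ => 1 / y := by fun_prop
  have hi : ∀ x : ℝ, Integrable (fun y : ℝ => 1 / y * Real.exp (y * x)) (ν.restrict (Ioi 0)) := by
    intro x
    refine ((hinv.integrable.const_mul (Real.exp |x|)).add (hexp x).integrable).mono'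
      (by fun_prop) ?_
    filter_upwards [hpos] with y hy
    rw [Real.norm_of_nonneg (by positivity)]
    change _ ≤ Real.exp |x| * (1 / y) + Real.exp (y * x)
    rcases le_total y 1 with hy1 | hy1
    · have h1 : y * x ≤ |x| := by nlinarith [le_abs_self x, abs_nonneg x]
      have h2 : 1 / y * Real.exp (y * x) ≤ 1 / y * Real.exp |x| := by gcongr
      linarith [Real.exp_nonneg (y * x)]
    · have h1 : 1 / y ≤ 1 := by rwa [div_le_one hy]
      have h2 : 1 / y * Real.exp (y * x) ≤ 1 * Real.exp (y * x) := by gcongr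
      have h3 : 0 ≤ Real.exp |x| * (1 / y) := by positivity
      linarith
  have hi1 := integrable_mul_id_mul_exp hpos hg hi
  have hh : h = fun x t =>
      ∫ y, 1 / y * Real.exp (y * x - y ^ 2 * t / 2) ∂ν.restrict (Ioi 0) := by
    funext x t
    rw [hdef]
    simp only [one_div_mul_eq_div]
  subst hh
  refine ⟨fun x t ht => ?_, fun x t ht => ?_, fun t ht => ?_, ?_, fun x t ht => ?_⟩
  · simpa only [IntegrableOn, one_div_mul_eq_div] using integrable_mul_exp_heat hpos hg hi x ht
  · refine integral_pos_of_ae_pos hμ (integrable_mul_exp_heat hpos hg hi x ht) ?_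
    filter_upwards [hpos] with y hy
    positivity
  · refine strictMono_of_hasDerivAt_pos
      (fun x => hasDerivAt_integral_mul_exp_heat_space hpos hg hi x ht) fun x => ?_
    refine integral_pos_of_ae_pos hμ (integrable_mul_exp_heat hpos (by fun_prop) hi1 x ht) ?_
    filter_upwards [hpos] with y hy
    positivity
  · exact continuousOn_integral_mul_exp_heat hpos hg hi
  · rw [(hasDerivAt_integral_mul_exp_heat_time hpos hg hi x ht).deriv, iteratedDeriv_succ,
      iteratedDeriv_one,
      funext fun z => (hasDerivAt_integral_mul_exp_heat_space hpos hg hi z ht.le).deriv,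
      (hasDerivAt_integral_mul_exp_heat_space hpos (by fun_prop) hi1 x ht.le).deriv]
    ring
end

section
/- Let h : ℝ × [0,∞) → (0,∞) be such that on ℝ × (0,∞), h has continuous partial derivatives ∂_x h, ∂_{xx} h, ∂_t h with ∂_x h > 0 and ∂_t h + (1/2)∂_{xx} h = 0, and suppose that for each t the map x ↦ h(x,t) is a bijection from ℝ onto (0,∞). Let u : (0,∞) × [0,∞) → ℝ be such that on (0,∞) × (0,∞), u has continuous partial derivatives ∂_z u, ∂_{zz} u, ∂_{zzz} u, ∂_t u, ∂_{tz} u, and suppose u is related to h by ∂_z u(h(x,t), t) = e^{−x + t/2} for all (x,t) ∈ ℝ × (0,∞). Then: (i) ∂_z u > 0 and ∂_{zz} u < 0 on (0,∞) × (0,∞), that is, u is strictly increasing and strictly concave in its first variable; and (ii) for each fixed t > 0, the quantity ∂_t u(z,t) − (∂_z u(z,t))²/(2 ∂_{zz} u(z,t)) does not depend on z ∈ (0,∞). -/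
open Set

open Filter Topology MeasureTheory in
/-- Chain rule along the curve `s ↦ (γ s, s)` for a bivariate function with continuous partial
derivatives near `(γ t, t)`. -/
theorem hasDerivAt_comp_curve_of_partial {f f₁ f₂ : ℝ → ℝ → ℝ} {γ : ℝ → ℝ} {γ' t : ℝ}
    (df₁ : ∀ᶠ p : ℝ × ℝ in 𝓝 (γ t, t), HasDerivAt (fun x => f x p.2) (f₁ p.1 p.2) p.1)
    (df₂ : ∀ᶠ p : ℝ × ℝ in 𝓝 (γ t, t), HasDerivAt (fun s => f p.1 s) (f₂ p.1 p.2) p.2)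
    (cf₁ : ContinuousAt (fun p : ℝ × ℝ => f₁ p.1 p.2) (γ t, t))
    (cf₂ : ContinuousAt (fun p : ℝ × ℝ => f₂ p.1 p.2) (γ t, t))
    (hγ : HasDerivAt γ γ' t) :
    HasDerivAt (fun s => f (γ s) s) (f₁ (γ t) t * γ' + f₂ (γ t) t) t := by
  have key := hasStrictFDerivAt_uncurry_coprod (𝕜 := ℝ) (u := (γ t, t)) (f := f)
    (f₁ := fun x s => ContinuousLinearMap.toSpanSingleton ℝ (f₁ x s))
    (f₂ := fun x s => ContinuousLinearMap.toSpanSingleton ℝ (f₂ x s))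
    (df₁.mono fun _ hp => hp.hasFDerivAt) (df₂.mono fun _ hp => hp.hasFDerivAt)
    ((ContinuousLinearMap.toSpanSingletonCLE (𝕜 := ℝ) (E := ℝ)).continuous.continuousAt.comp cf₁)
    ((ContinuousLinearMap.toSpanSingletonCLE (𝕜 := ℝ) (E := ℝ)).continuous.continuousAt.comp cf₂)
  have hcomp := HasFDerivAt.comp_hasDerivAt (f := fun s => (γ s, s)) t key.hasFDerivAt
    (hγ.prodMk (hasDerivAt_id t))
  refine hcomp.congr_deriv ?_
  simp [Function.HasUncurry.uncurry, mul_comm]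

open Filter Topology MeasureTheory in
/-- If `∂_z u = v` and `∂_t v = v'` on the open quadrant, with `v` and `v'` continuous, then the
increment of `∂_t u` in `z` is the integral of `v'`. -/
theorem integral_eq_sub_deriv_of_mixed_partial {u v v' : ℝ → ℝ → ℝ}
    (hu : ∀ z t : ℝ, 0 < z → 0 < t → HasDerivAt (fun w => u w t) (v z t) z)
    (hut : ∀ z t : ℝ, 0 < z → 0 < t → DifferentiableAt ℝ (fun s => u z s) t)
    (hv : ∀ z t : ℝ, 0 < z → 0 < t → HasDerivAt (fun s => v z s) (v' z t) t)
    (hvc : ContinuousOn (fun p : ℝ × ℝ => v p.1 p.2) (Ioi 0 ×ˢ Ioi 0))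
    (hvc' : ContinuousOn (fun p : ℝ × ℝ => v' p.1 p.2) (Ioi 0 ×ˢ Ioi 0))
    {a b t : ℝ} (ha : 0 < a) (hb : 0 < b) (ht : 0 < t) :
    IntervalIntegrable (fun z => v' z t) volume a b ∧
      ∫ z in a..b, v' z t = deriv (fun s => u b s) t - deriv (fun s => u a s) t := by
  have hsub : uIcc a b ⊆ Ioi 0 := ordConnected_Ioi.uIcc_subset ha hb
  have slice {g : ℝ → ℝ → ℝ} (hg : ContinuousOn (fun p : ℝ × ℝ => g p.1 p.2) (Ioi 0 ×ˢ Ioi 0))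
      {s : ℝ} (hs : 0 < s) : IntervalIntegrable (fun z => g z s) volume a b :=
    (hg.comp (f := fun z => (z, s)) (by fun_prop)
      fun z hz => ⟨hsub hz, hs⟩).intervalIntegrable
  obtain ⟨C, hC⟩ := (isCompact_uIcc.prod (isCompact_Icc (a := t / 2) (b := 2 * t))
    ).exists_bound_of_continuousOn (hvc'.mono (prod_mono hsub fun s hs =>
      (half_pos ht).trans_le hs.1))
  have hint := (intervalIntegral.hasDerivAt_integral_of_dominated_loc_of_deriv_le
    (μ := volume) (a := a) (b := b) (F := fun s z => v z s) (F' := fun s z => v' z s)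
    (bound := fun _ => C) (x₀ := t) (Icc_mem_nhds (half_lt_self ht) (by linarith : t < 2 * t))
    ((eventually_gt_nhds ht).mono fun s hs => (slice hvc hs).def'.aestronglyMeasurable)
    (slice hvc ht) (slice hvc' ht).def'.aestronglyMeasurable
    (ae_of_all _ fun z hz s hs => hC (z, s) ⟨uIoc_subset_uIcc hz, hs⟩)
    intervalIntegrable_const
    (ae_of_all _ fun z hz s hs =>
      hv z s (hsub (uIoc_subset_uIcc hz)) ((half_pos ht).trans_le hs.1))).2
  refine ⟨slice hvc' ht, hint.unique ?_⟩
  refine ((hut b t hb ht).hasDerivAt.sub (hut a t ha ht).hasDerivAt).congr_of_eventuallyEq ?_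
  filter_upwards [eventually_gt_nhds ht] with s hs
  exact intervalIntegral.integral_eq_sub_of_hasDerivAt
    (fun z hz => hu z s (hsub hz) hs) (slice hvc hs)

/-- Differential relation between the space-time harmonic function `h` (solving
`h_t + (1/2)h_xx = 0`, with `h_x > 0`, a spatial bijection onto `(0,∞)`) and the local
risk preference function `u` linked to it via `u_z(h(x,t),t) = e^{-x + t/2}`:
(i) `u` is strictly increasing and strictly concave in its spatial variable
(`u_z > 0`, `u_zz < 0`), and (ii) for each `t > 0` the quantity
`u_t - u_z²/(2u_zz)` does not depend on the spatial variable. -/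
theorem forward_u_increasing_concave_and_pde
    (h u : ℝ → ℝ → ℝ)
    (hmaps : ∀ x t : ℝ, 0 ≤ t → 0 < h x t)
    (hhx : ∀ x t : ℝ, 0 < t → DifferentiableAt ℝ (fun z => h z t) x)
    (hhxx : ∀ x t : ℝ, 0 < t → DifferentiableAt ℝ (deriv fun z => h z t) x)
    (hht : ∀ x t : ℝ, 0 < t → DifferentiableAt ℝ (fun s => h x s) t)
    (hhxc : ContinuousOn (fun p : ℝ × ℝ => deriv (fun z => h z p.2) p.1) (univ ×ˢ Ioi 0))
    (hhxxc : ContinuousOn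
      (fun p : ℝ × ℝ => deriv (deriv fun z => h z p.2) p.1) (univ ×ˢ Ioi 0))
    (hhtc : ContinuousOn (fun p : ℝ × ℝ => deriv (fun s => h p.1 s) p.2) (univ ×ˢ Ioi 0))
    (hhxpos : ∀ x t : ℝ, 0 < t → 0 < deriv (fun z => h z t) x)
    (hhpde : ∀ x t : ℝ, 0 < t →
      deriv (fun s => h x s) t + (1 / 2) * deriv (deriv fun z => h z t) x = 0)
    (hbij : ∀ t : ℝ, 0 < t → BijOn (fun x => h x t) univ (Ioi 0))
    (huz : ∀ z t : ℝ, 0 < z → 0 < t → DifferentiableAt ℝ (fun w => u w t) z)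
    (huzz : ∀ z t : ℝ, 0 < z → 0 < t → DifferentiableAt ℝ (deriv fun w => u w t) z)
    (huzzz : ∀ z t : ℝ, 0 < z → 0 < t →
      DifferentiableAt ℝ (deriv (deriv fun w => u w t)) z)
    (hut : ∀ z t : ℝ, 0 < z → 0 < t → DifferentiableAt ℝ (fun s => u z s) t)
    (hutz : ∀ z t : ℝ, 0 < z → 0 < t →
      DifferentiableAt ℝ (fun s => deriv (fun w => u w s) z) t)
    (huzc : ContinuousOn (fun p : ℝ × ℝ => deriv (fun w => u w p.2) p.1) (Ioi 0 ×ˢ Ioi 0))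
    (huzzc : ContinuousOn
      (fun p : ℝ × ℝ => deriv (deriv fun w => u w p.2) p.1) (Ioi 0 ×ˢ Ioi 0))
    (huzzzc : ContinuousOn
      (fun p : ℝ × ℝ => deriv (deriv (deriv fun w => u w p.2)) p.1) (Ioi 0 ×ˢ Ioi 0))
    (hutc : ContinuousOn (fun p : ℝ × ℝ => deriv (fun s => u p.1 s) p.2) (Ioi 0 ×ˢ Ioi 0))
    (hutzc : ContinuousOn
      (fun p : ℝ × ℝ => deriv (fun s => deriv (fun w => u w s) p.1) p.2) (Ioi 0 ×ˢ Ioi 0))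
    (hrel : ∀ x t : ℝ, 0 < t → deriv (fun w => u w t) (h x t) = Real.exp (-x + t / 2)) :
    (∀ z t : ℝ, 0 < z → 0 < t →
      0 < deriv (fun w => u w t) z ∧ deriv (deriv fun w => u w t) z < 0) ∧
    (∀ t : ℝ, 0 < t → ∀ z₁ z₂ : ℝ, 0 < z₁ → 0 < z₂ →
      deriv (fun s => u z₁ s) t -
          (deriv (fun w => u w t) z₁) ^ 2 / (2 * deriv (deriv fun w => u w t) z₁) =
        deriv (fun s => u z₂ s) t -
          (deriv (fun w => u w t) z₂) ^ 2 / (2 * deriv (deriv fun w => u w t) z₂)) := by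
  have hH (x t : ℝ) (ht : 0 < t) := (hhx x t ht).hasDerivAt
  have hE (x t : ℝ) : HasDerivAt (fun y => Real.exp (-y + t / 2)) (-Real.exp (-x + t / 2)) x := by
    simpa using (((hasDerivAt_id x).neg.add_const (t / 2)).exp)
  have hEt (x t : ℝ) :
      HasDerivAt (fun s => Real.exp (-x + s / 2)) (Real.exp (-x + t / 2) / 2) t := by
    simpa [div_eq_mul_inv] using ((((hasDerivAt_id t).div_const 2).const_add (-x)).exp)
  have first_order (x t : ℝ) (ht : 0 < t) :
      deriv (deriv fun w => u w t) (h x t) * deriv (fun z => h z t) x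
        = -Real.exp (-x + t / 2) := by
    have hc := (huzz (h x t) t (hmaps x t ht.le) ht).hasDerivAt.comp x (hH x t ht)
    refine hc.unique ((hE x t).congr_of_eventuallyEq (.of_forall fun y => hrel y t ht))
  have second_order (x t : ℝ) (ht : 0 < t) :
      deriv (deriv (deriv fun w => u w t)) (h x t) * deriv (fun z => h z t) x
          * deriv (fun z => h z t) x
        + deriv (deriv fun w => u w t) (h x t) * deriv (deriv fun z => h z t) x
        = Real.exp (-x + t / 2) := by
    have hc := ((huzzz (h x t) t (hmaps x t ht.le) ht).hasDerivAt.comp x (hH x t ht)).mul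
      (hhxx x t ht).hasDerivAt
    refine hc.unique (((hE x t).neg.congr_deriv (neg_neg _)).congr_of_eventuallyEq
      (.of_forall fun y => first_order y t ht))
  have quadrant {z t : ℝ} (hz : 0 < z) (ht : 0 < t) :
      (Ioi 0 ×ˢ Ioi 0 : Set (ℝ × ℝ)) ∈ nhds (z, t) :=
    prod_mem_nhds (Ioi_mem_nhds hz) (Ioi_mem_nhds ht)
  have time_order (x t : ℝ) (ht : 0 < t) :
      deriv (deriv fun w => u w t) (h x t) * deriv (fun s => h x s) t
        + deriv (fun s => deriv (fun w => u w s) (h x t)) t = Real.exp (-x + t / 2) / 2 := by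
    have hq := quadrant (hmaps x t ht.le) ht
    have hc := hasDerivAt_comp_curve_of_partial (γ := fun s => h x s)
      (f := fun z s => deriv (fun w => u w s) z)
      (f₁ := fun z s => deriv (deriv fun w => u w s) z)
      (f₂ := fun z s => deriv (fun r => deriv (fun w => u w r) z) s)
      (Filter.mem_of_superset hq fun p hp => (huzz p.1 p.2 hp.1 hp.2).hasDerivAt)
      (Filter.mem_of_superset hq fun p hp => (hutz p.1 p.2 hp.1 hp.2).hasDerivAt)
      (huzzc.continuousAt hq) (hutzc.continuousAt hq) (hht x t ht).hasDerivAt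
    refine hc.unique ((hEt x t).congr_of_eventuallyEq ?_)
    filter_upwards [eventually_gt_nhds ht] with s hs using hrel x s hs
  have pos_neg (z t : ℝ) (hz : 0 < z) (ht : 0 < t) :
      0 < deriv (fun w => u w t) z ∧ deriv (deriv fun w => u w t) z < 0 := by
    obtain ⟨x, -, rfl⟩ := (hbij t ht).surjOn hz
    refine ⟨(hrel x t ht).symm ▸ Real.exp_pos _, ?_⟩
    refine neg_of_mul_neg_left ?_ (hhxpos x t ht).le
    rw [first_order x t ht]
    exact neg_lt_zero.2 (Real.exp_pos _)
  refine ⟨pos_neg, fun t ht z₁ z₂ hz₁ hz₂ => ?_⟩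
  have hF (z : ℝ) (hz : 0 < z) :
      HasDerivAt
        (fun z => (deriv (fun w => u w t) z) ^ 2 / (2 * deriv (deriv fun w => u w t) z))
        (deriv (fun s => deriv (fun w => u w s) z) t) z := by
    have hne := (pos_neg z t hz ht).2.ne
    refine (((huzz z t hz ht).hasDerivAt.pow 2).div
      ((huzzz z t hz ht).hasDerivAt.const_mul 2) (mul_ne_zero two_ne_zero hne)).congr_deriv ?_
    obtain ⟨x, -, rfl⟩ := (hbij t ht).surjOn hz
    have h₁ := first_order x t ht
    have h₂ := second_order x t ht
    have h₃ := time_order x t ht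
    have h₄ := hhpde x t ht
    have h₅ := hrel x t ht
    beta_reduce at hne ⊢
    simp only [Pi.pow_apply]
    generalize deriv (fun s => deriv (fun w => u w s) (h x t)) t = vt at *
    generalize deriv (deriv (deriv fun w => u w t)) (h x t) = vzz at *
    generalize deriv (deriv fun w => u w t) (h x t) = vz at *
    generalize deriv (fun w => u w t) (h x t) = v at *
    generalize deriv (deriv fun z => h z t) x = hxx at *
    generalize deriv (fun z => h z t) x = hx at *
    generalize deriv (fun s => h x s) t = ht' at *
    generalize Real.exp (-x + t / 2) = e at *
    obtain rfl : v = -(vz * hx) := by linarith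
    have hvt : vt = -(vz * hx) - vzz * hx ^ 2 / 2 := by
      linear_combination h₃ - vz * h₄ + h₂ / 2 - h₅
    rw [hvt]
    field_simp
    ring
  obtain ⟨hint, hu⟩ := integral_eq_sub_deriv_of_mixed_partial
    (u := u) (v := fun z s => deriv (fun w => u w s) z)
    (v' := fun z s => deriv (fun r => deriv (fun w => u w r) z) s)
    (fun z s hz hs => (huz z s hz hs).hasDerivAt) hut
    (fun z s hz hs => (hutz z s hz hs).hasDerivAt) huzc hutzc hz₁ hz₂ ht
  have hFTC := intervalIntegral.integral_eq_sub_of_hasDerivAt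
    (fun z hz => hF z (ordConnected_Ioi.uIcc_subset hz₁ hz₂ hz)) hint
  linarith
end

section
/- Let A > 0 and let ν be a finite Borel measure on ℝ with ν((−∞,0]) = 0 such that ∫_{(0,∞)} e^{yx} ν(dy) < ∞ for every x ∈ ℝ. Then for every x ∈ ℝ, the complex-valued integral (1/√(2πA)) ∫_ℝ e^{−(ix−s)²/(2A)} (∫_{(0,∞)} e^{ys − y²A/2} ν(dy)) ds converges and equals ∫_{(0,∞)} e^{iyx} ν(dy), the Fourier transform of ν evaluated at x (here i is the imaginary unit and the exponentials are complex exponentials). -/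
open MeasureTheory Set

/-- The norm of the complex Gaussian heat kernel at `i x` times the exponential
`e^{ys - y²A/2}` is a real Gaussian in `s` centred at `A y`. -/
lemma norm_gaussian_mul_exp {A : ℝ} (hA : 0 < A) (x y s : ℝ) :
    ‖Complex.exp (-(Complex.I * x - s) ^ 2 / (2 * A)) *
        (Real.exp (y * s - y ^ 2 * A / 2) : ℂ)‖ =
      Real.exp (x ^ 2 / (2 * A)) * Real.exp (-(1 / (2 * A)) * (s - A * y) ^ 2) := by
  have h : -(Complex.I * x - s) ^ 2 / (2 * A) =
      (((x ^ 2 - s ^ 2) / (2 * A) : ℝ) : ℂ) + ((x * s / A : ℝ) : ℂ) * Complex.I := by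
    have hA' : (A : ℂ) ≠ 0 := by exact_mod_cast hA.ne'
    push_cast
    field_simp
    linear_combination (-(x : ℂ) ^ 2) * Complex.I_sq
  rw [norm_mul, h, Complex.norm_exp, Complex.norm_real, Real.norm_eq_abs, Real.abs_exp,
    ← Real.exp_add, ← Real.exp_add]
  congr 1
  simp only [Complex.add_re, Complex.ofReal_re, Complex.re_ofReal_mul, Complex.I_re, mul_zero,
    add_zero]
  field_simp
  ring

lemma gaussian_mul_exp_eq {A : ℝ} (hA : 0 < A) (x y s : ℝ) :
    Complex.exp (-(Complex.I * x - s) ^ 2 / (2 * A)) *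
        (Real.exp (y * s - y ^ 2 * A / 2) : ℂ) =
      Complex.exp (((-(1 / (2 * A)) : ℝ) : ℂ) * (s : ℂ) ^ 2 + (Complex.I * x / A + y) * s +
        ((x : ℂ) ^ 2 / (2 * A) - (y : ℂ) ^ 2 * A / 2)) := by
  have hA' : (A : ℂ) ≠ 0 := by exact_mod_cast hA.ne'
  rw [Complex.ofReal_exp, ← Complex.exp_add]
  congr 1
  push_cast
  field_simp
  linear_combination (-(x : ℂ) ^ 2) * Complex.I_sq

lemma integral_gaussian_mul_exp {A : ℝ} (hA : 0 < A) (x y : ℝ) :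
    ∫ s : ℝ, Complex.exp (-(Complex.I * x - s) ^ 2 / (2 * A)) *
        (Real.exp (y * s - y ^ 2 * A / 2) : ℂ) =
      (Real.sqrt (2 * Real.pi * A) : ℂ) * Complex.exp (Complex.I * y * x) := by
  have hA' : (A : ℂ) ≠ 0 := by exact_mod_cast hA.ne'
  have hb : ((-(1 / (2 * A)) : ℝ) : ℂ).re < 0 := by
    rw [Complex.ofReal_re]
    exact neg_lt_zero.2 (by positivity)
  simp_rw [gaussian_mul_exp_eq hA]
  rw [integral_cexp_quadratic hb]
  congr 1
  · rw [Real.sqrt_eq_rpow, Complex.ofReal_cpow (by positivity)]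
    congr 1
    · push_cast
      field_simp
    · norm_num
  · congr 1
    push_cast
    field_simp
    linear_combination (4 * (x : ℂ) ^ 2) * Complex.I_sq

lemma integrable_gaussian_mul_exp {A : ℝ} (hA : 0 < A) (x y : ℝ) :
    Integrable fun s : ℝ => Complex.exp (-(Complex.I * x - s) ^ 2 / (2 * A)) *
        (Real.exp (y * s - y ^ 2 * A / 2) : ℂ) := by
  refine (integrable_norm_iff (by fun_prop)).1 ?_
  simp_rw [norm_gaussian_mul_exp hA]
  exact ((integrable_exp_neg_mul_sq (b := 1 / (2 * A)) (by positivity)).comp_sub_right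
    (A * y)).const_mul _

/-- Joint integrability against any finite measure in the variable `y`: the integral of the norm
over `s` does not depend on `y`. -/
lemma integrable_prod_gaussian_mul_exp {A : ℝ} (hA : 0 < A) (x : ℝ)
    (μ : Measure ℝ) [IsFiniteMeasure μ] :
    Integrable (fun p : ℝ × ℝ => Complex.exp (-(Complex.I * x - p.2) ^ 2 / (2 * A)) *
        (Real.exp (p.1 * p.2 - p.1 ^ 2 * A / 2) : ℂ)) (μ.prod volume) := by
  refine (integrable_prod_iff (by fun_prop)).2
    ⟨.of_forall fun y => integrable_gaussian_mul_exp hA x y, ?_⟩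
  have h (y : ℝ) : ∫ s : ℝ, ‖Complex.exp (-(Complex.I * x - s) ^ 2 / (2 * A)) *
      (Real.exp (y * s - y ^ 2 * A / 2) : ℂ)‖ =
      Real.exp (x ^ 2 / (2 * A)) * ∫ s : ℝ, Real.exp (-(1 / (2 * A)) * s ^ 2) := by
    simp_rw [norm_gaussian_mul_exp hA, integral_const_mul]
    rw [integral_sub_right_eq_self (fun s : ℝ => Real.exp (-(1 / (2 * A)) * s ^ 2)) (A * y)]
  simp_rw [h]
  exact integrable_const _

/-- Recovering the Fourier transform of the measure `ν` encoding the investor's risk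
preferences: for every `x ∈ ℝ`, the complex integral
`(2πA)^{-1/2} ∫ e^{-(ix-s)²/(2A)} (∫_{(0,∞)} e^{ys - y²A/2} ν(dy)) ds`
converges and equals the Fourier transform `∫_{(0,∞)} e^{iyx} ν(dy)`. -/
theorem heat_kernel_convolution_gives_fourier_transform
    (A : ℝ) (hA : 0 < A)
    (ν : Measure ℝ) [IsFiniteMeasure ν] (hsupp : ν (Iic 0) = 0)
    (hexp : ∀ x : ℝ, IntegrableOn (fun y : ℝ => Real.exp (y * x)) (Ioi 0) ν) :
    ∀ x : ℝ,
      (Integrable fun s : ℝ =>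
        Complex.exp (-(Complex.I * x - s) ^ 2 / (2 * A)) *
          ((∫ y in Ioi 0, Real.exp (y * s - y ^ 2 * A / 2) ∂ν : ℝ) : ℂ)) ∧
      ((Real.sqrt (2 * Real.pi * A) : ℂ))⁻¹ *
          ∫ s : ℝ, Complex.exp (-(Complex.I * x - s) ^ 2 / (2 * A)) *
            ((∫ y in Ioi 0, Real.exp (y * s - y ^ 2 * A / 2) ∂ν : ℝ) : ℂ) =
        ∫ y in Ioi 0, Complex.exp (Complex.I * y * x) ∂ν := by
  intro x
  have hint := integrable_prod_gaussian_mul_exp hA x (ν.restrict (Ioi 0))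
  have hinner (s : ℝ) : Complex.exp (-(Complex.I * x - s) ^ 2 / (2 * A)) *
      ((∫ y in Ioi 0, Real.exp (y * s - y ^ 2 * A / 2) ∂ν : ℝ) : ℂ) =
      ∫ y in Ioi 0, Complex.exp (-(Complex.I * x - s) ^ 2 / (2 * A)) *
        (Real.exp (y * s - y ^ 2 * A / 2) : ℂ) ∂ν := by
    rw [integral_const_mul, integral_complex_ofReal]
  simp_rw [hinner]
  refine ⟨hint.integral_prod_right, ?_⟩
  have hsqrt : (Real.sqrt (2 * Real.pi * A) : ℂ) ≠ 0 := by
    exact_mod_cast (Real.sqrt_pos.2 (by positivity)).ne'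
  rw [← integral_integral_swap hint]
  simp_rw [integral_gaussian_mul_exp hA]
  rw [integral_const_mul, inv_mul_cancel_left₀ hsqrt]
end

section
/- Let A > 0, let K > 0 and a > 0 be constants, and let F : (0,∞) → (0,1) be a continuous, strictly increasing bijection whose inverse F^{(−1)} satisfies F^{(−1)}(Φ(x)) ≤ K·e^{a|x|} for all x ∈ ℝ. Let Φ^{(−1)} : (0,1) → ℝ denote the inverse of Φ. Then (1/√(2πA)) ∫_ℝ e^{−y²/(2A)}·F^{(−1)}(Φ((y − A)/√A)) dy = ∫₀¹ e^{−A/2 − √A·Φ^{(−1)}(u)}·F^{(−1)}(u) du, with both integrals finite. -/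
open MeasureTheory Set

/-- The standard normal distribution function. -/
noncomputable def stdNormalCdf (x : ℝ) : ℝ :=
  (Real.sqrt (2 * Real.pi))⁻¹ * ∫ s in Iic x, Real.exp (-s ^ 2 / 2)

/-- The unnormalised standard Gaussian density, translated by `m`, is integrable. -/
lemma integrable_exp_neg_add_sq_div_two (m : ℝ) :
    Integrable fun x : ℝ => Real.exp (-(x + m) ^ 2 / 2) := by
  have h := (integrable_exp_neg_mul_sq (b := 1 / 2) (by norm_num)).comp_add_right m
  convert h using 3
  ring

lemma integrable_exp_neg_sq_div_two : Integrable fun x : ℝ => Real.exp (-x ^ 2 / 2) := by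
  simpa using integrable_exp_neg_add_sq_div_two 0

lemma integral_exp_neg_sq_div_two : ∫ x : ℝ, Real.exp (-x ^ 2 / 2) = √(2 * Real.pi) := by
  have h := integral_gaussian (1 / 2)
  rw [show Real.pi / (1 / 2) = 2 * Real.pi by ring] at h
  rw [← h]
  congr 1 with x
  ring_nf

lemma integrable_exp_mul_exp_neg_add_sq_div_two (m b : ℝ) :
    Integrable fun x : ℝ => Real.exp (-(x + m) ^ 2 / 2) * Real.exp (b * x) := by
  convert (integrable_exp_neg_add_sq_div_two (m - b)).mul_const
    (Real.exp (b ^ 2 / 2 - b * m)) using 2 with x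
  rw [← Real.exp_add, ← Real.exp_add]
  ring_nf

lemma hasDerivAt_stdNormalCdf (x : ℝ) :
    HasDerivAt stdNormalCdf ((√(2 * Real.pi))⁻¹ * Real.exp (-x ^ 2 / 2)) x := by
  have hc : Continuous fun s : ℝ => Real.exp (-s ^ 2 / 2) := by fun_prop
  have hi := integrable_exp_neg_sq_div_two
  have hsplit : stdNormalCdf = fun x => (√(2 * Real.pi))⁻¹ *
      ((∫ s in Iic 0, Real.exp (-s ^ 2 / 2)) + ∫ s in (0 : ℝ)..x, Real.exp (-s ^ 2 / 2)) := by
    ext x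
    rw [stdNormalCdf, ← intervalIntegral.integral_Iic_sub_Iic hi.integrableOn hi.integrableOn]
    ring
  rw [hsplit]
  exact ((hc.integral_hasStrictDerivAt 0 x).hasDerivAt.const_add _).const_mul _

lemma strictMono_stdNormalCdf : StrictMono stdNormalCdf :=
  strictMono_of_deriv_pos fun x => by
    rw [(hasDerivAt_stdNormalCdf x).deriv]
    positivity

lemma stdNormalCdf_mem_Ioo (x : ℝ) : stdNormalCdf x ∈ Ioo (0 : ℝ) 1 := by
  have nonneg (y : ℝ) : 0 ≤ stdNormalCdf y :=
    mul_nonneg (by positivity) (integral_nonneg fun _ => (Real.exp_pos _).le)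
  have le_one (y : ℝ) : stdNormalCdf y ≤ 1 := by
    rw [stdNormalCdf, inv_mul_le_iff₀ (by positivity), mul_one, ← integral_exp_neg_sq_div_two]
    exact setIntegral_le_integral integrable_exp_neg_sq_div_two
      (Filter.Eventually.of_forall fun _ => (Real.exp_pos _).le)
  exact ⟨(nonneg (x - 1)).trans_lt (strictMono_stdNormalCdf (by linarith)),
    (strictMono_stdNormalCdf (by linarith : x < x + 1)).trans_le (le_one _)⟩

/-- A Gaussian density times a measurable function of at most exponential growth is integrable. -/
lemma integrable_exp_neg_add_sq_div_two_mul {G : ℝ → ℝ} {K a : ℝ} (hG : Measurable G)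
    (hbound : ∀ x, |G x| ≤ K * Real.exp (a * |x|)) (hK : 0 ≤ K) (m : ℝ) :
    Integrable fun x : ℝ => Real.exp (-(x + m) ^ 2 / 2) * G x := by
  refine Integrable.mono' (((integrable_exp_mul_exp_neg_add_sq_div_two m a).add
    (integrable_exp_mul_exp_neg_add_sq_div_two m (-a))).const_mul K)
    (by fun_prop) (Filter.Eventually.of_forall fun x => ?_)
  have habs : Real.exp (a * |x|) ≤ Real.exp (a * x) + Real.exp (-a * x) := by
    rcases abs_cases x with ⟨h, -⟩ | ⟨h, -⟩ <;> rw [h]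
    · linarith [Real.exp_pos (-a * x)]
    · rw [mul_neg, ← neg_mul]
      linarith [Real.exp_pos (a * x)]
  rw [Real.norm_eq_abs, abs_mul, Real.abs_exp]
  calc Real.exp (-(x + m) ^ 2 / 2) * |G x|
      ≤ Real.exp (-(x + m) ^ 2 / 2) * (K * (Real.exp (a * x) + Real.exp (-a * x))) := by
        gcongr
        exact (hbound x).trans (by gcongr)
    _ = _ := by
        simp only [Pi.add_apply]
        ring

/-- Dybvig's distributional price identity: the initial cost of attaining the terminal
wealth distribution `F` equals the distributional price, i.e.
`(2πA)^{-1/2} ∫_ℝ e^{-y²/(2A)} F⁻¹(Φ((y-A)/√A)) dy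
  = ∫₀¹ e^{-A/2 - √A Φ⁻¹(u)} F⁻¹(u) du`, with both integrals finite. -/
theorem distributional_price_identity
    (A K a : ℝ) (hA : 0 < A) (hK : 0 < K) (ha : 0 < a)
    (F Finv Phinv : ℝ → ℝ)
    (hFmem : ∀ x : ℝ, 0 < x → F x ∈ Ioo (0 : ℝ) 1)
    (hFcont : ContinuousOn F (Ioi 0))
    (hFmono : StrictMonoOn F (Ioi 0))
    (hFsurj : ∀ u ∈ Ioo (0 : ℝ) 1, ∃ x, 0 < x ∧ F x = u)
    (hFinv : ∀ x : ℝ, 0 < x → Finv (F x) = x)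
    (hgrowth : ∀ x : ℝ, Finv (stdNormalCdf x) ≤ K * Real.exp (a * |x|))
    (hPhinv : ∀ x : ℝ, Phinv (stdNormalCdf x) = x)
    (hPhinv' : ∀ u ∈ Ioo (0 : ℝ) 1, stdNormalCdf (Phinv u) = u) :
    (Integrable fun y : ℝ =>
      Real.exp (-y ^ 2 / (2 * A)) * Finv (stdNormalCdf ((y - A) / Real.sqrt A))) ∧
    IntegrableOn (fun u : ℝ =>
      Real.exp (-A / 2 - Real.sqrt A * Phinv u) * Finv u) (Ioo 0 1) ∧
    (Real.sqrt (2 * Real.pi * A))⁻¹ *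
        ∫ y, Real.exp (-y ^ 2 / (2 * A)) * Finv (stdNormalCdf ((y - A) / Real.sqrt A)) =
      ∫ u in Ioo (0 : ℝ) 1, Real.exp (-A / 2 - Real.sqrt A * Phinv u) * Finv u := by
  have hinv : ∀ u ∈ Ioo (0 : ℝ) 1, 0 < Finv u ∧ F (Finv u) = u := by
    intro u hu
    obtain ⟨x, hx, rfl⟩ := hFsurj u hu
    rw [hFinv x hx]
    exact ⟨hx, rfl⟩
  have hGmono : Monotone fun x => Finv (stdNormalCdf x) := by
    intro x y hxy
    obtain ⟨hx, hx'⟩ := hinv _ (stdNormalCdf_mem_Ioo x)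
    obtain ⟨hy, hy'⟩ := hinv _ (stdNormalCdf_mem_Ioo y)
    refine (hFmono.le_iff_le hx hy).1 ?_
    rw [hx', hy']
    exact strictMono_stdNormalCdf.monotone hxy
  have himage : stdNormalCdf '' univ = Ioo 0 1 := by
    ext u
    constructor
    · rintro ⟨x, -, rfl⟩
      exact stdNormalCdf_mem_Ioo x
    · exact fun hu => ⟨Phinv u, mem_univ _, hPhinv' u hu⟩
  have hs : 0 < √A := Real.sqrt_pos.2 hA
  have hss : √A ^ 2 = A := Real.sq_sqrt hA.le
  set g : ℝ → ℝ := fun x => Real.exp (-(x + √A) ^ 2 / 2) * Finv (stdNormalCdf x) with hg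
  have hgint : Integrable g := by
    refine integrable_exp_neg_add_sq_div_two_mul hGmono.measurable (K := K) (a := a)
      (fun x => ?_) hK.le _
    rw [abs_of_pos (hinv _ (stdNormalCdf_mem_Ioo x)).1]
    exact hgrowth x
  have hleft : (fun y : ℝ => Real.exp (-y ^ 2 / (2 * A)) *
      Finv (stdNormalCdf ((y - A) / √A))) = fun y => g ((y - A) / √A) := by
    ext y
    simp only [hg]
    congr 2
    have : (y - A) / √A + √A = y / √A := by
      field_simp
      linarith
    rw [this, div_pow, hss]
    field_simp
  have hright : (fun x : ℝ => |(√(2 * Real.pi))⁻¹ * Real.exp (-x ^ 2 / 2)| •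
      (Real.exp (-A / 2 - √A * Phinv (stdNormalCdf x)) * Finv (stdNormalCdf x))) =
      fun x => (√(2 * Real.pi))⁻¹ * g x := by
    ext x
    rw [hPhinv, abs_of_pos (by positivity), smul_eq_mul, mul_assoc, ← mul_assoc (Real.exp _),
      ← Real.exp_add]
    simp only [hg]
    congr 3
    nlinarith
  have hderiv : ∀ x ∈ (univ : Set ℝ), HasDerivWithinAt stdNormalCdf
      ((√(2 * Real.pi))⁻¹ * Real.exp (-x ^ 2 / 2)) univ x :=
    fun x _ => (hasDerivAt_stdNormalCdf x).hasDerivWithinAt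
  have hinj : InjOn stdNormalCdf univ := strictMono_stdNormalCdf.injective.injOn
  refine ⟨?_, ?_, ?_⟩
  · rw [hleft]
    exact (hgint.comp_div hs.ne').comp_sub_right A
  · rw [← himage, integrableOn_image_iff_integrableOn_abs_deriv_smul MeasurableSet.univ hderiv hinj,
      hright, integrableOn_univ]
    exact hgint.const_mul _
  · rw [← himage, integral_image_eq_integral_abs_deriv_smul MeasurableSet.univ hderiv hinj,
      hright, hleft, setIntegral_univ, integral_sub_right_eq_self (fun y => g (y / √A)) A,
      Measure.integral_comp_div, integral_const_mul, abs_of_pos hs, smul_eq_mul,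
      Real.sqrt_mul (by positivity) A]
    field_simp
end
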